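/- arXiv:1609.05058 — 2 statements merged into one kernel-verified Lean document; each statement's English description precedes it below -/
import Mathlib

section
/- There exists a reflective oracle. -/
namespace GrainOfTruth

open scoped Classical

/-- A probabilistic oracle Turing machine is given by a code of a partial
recursive function describing its finite-step behavior: on (input, bits received so far)
it either outputs a bit, flips a fair coin, or queries the oracle. -/
abbrev Machine := Nat.Partrec.Code

/-- A query to the oracle: a machine `T`, an input `x`, and a rational `p`. -/
abbrev Query := Machine × List Bool × ℚ

/-- An oracle probabilistically answers each query with `0` or `1`; we represent it by
the probability of answering `1`. -/
def IsOracle (O : Query → ℝ) : Prop := ∀ q, 0 ≤ O q ∧ O q ≤ 1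

instance : Denumerable (List Bool) := Denumerable.ofEncodableOfInfinite _

/-- The action a machine performs at a given configuration. -/
inductive Action : Type
  | output : Bool → Action
  | flip : Action
  | ask : Query → Action

/-- Decoding a natural number as an action. -/
def decodeAction : ℕ → Action
  | 0 => .output false
  | 1 => .output true
  | 2 => .flip
  | (n + 3) => .ask (Denumerable.ofNat Query n)

/-- The action performed by machine `T` on input `x` after having received the
bits `s` (fair coin flips and oracle answers) so far. -/
def act (T : Machine) (x s : List Bool) : Part Action :=
  (T.eval (Nat.pair (Encodable.encode x) (Encodable.encode s))).map decodeAction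

/-- Probability that the next received bit is `b`, given the current action. -/
noncomputable def bitProb (O : Query → ℝ) : Action → Bool → ℝ
  | .output _, _ => 0
  | .flip, _ => 1 / 2
  | .ask q, b => if b then O q else 1 - O q

/-- Probability that, running `T` with oracle `O` on input `x`, having already received
the bits `pre`, the machine receives exactly the further bits `s`. -/
noncomputable def traceWeightAux (T : Machine) (O : Query → ℝ) (x : List Bool) :
    List Bool → List Bool → ℝ
  | _pre, [] => 1
  | pre, b :: rest =>
      (if h : (act T x pre).Dom then bitProb O ((act T x pre).get h) b else 0) *
        traceWeightAux T O x (pre ++ [b]) rest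

/-- `lam T O x b` is the probability λ_T^O(b|x) that machine `T`, run with oracle `O`
on input `x`, outputs the bit `b`. -/
noncomputable def lam (T : Machine) (O : Query → ℝ) (x : List Bool) (b : Bool) : ℝ :=
  ∑' s : { s : List Bool // act T x s = Part.some (Action.output b) },
    traceWeightAux T O x [] s.1

/-- An oracle `O` is reflective iff for every query `(T, x, p)`:
if λ_T^O(1|x) > p then `O` answers `1` with probability one, and
if λ_T^O(0|x) > 1 - p then `O` answers `0` with probability one. -/
def Reflective (O : Query → ℝ) : Prop :=
  IsOracle O ∧
    ∀ (T : Machine) (x : List Bool) (p : ℚ),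
      ((p : ℝ) < lam T O x true → O (T, x, p) = 1) ∧
      (1 - (p : ℝ) < lam T O x false → O (T, x, p) = 0)

end GrainOfTruth

open Filter Topology Metric Set MeasureTheory

section Brouwer

variable {E : Type*} [NormedAddCommGroup E] [InnerProductSpace ℝ E] [FiniteDimensional ℝ E]

/-- The polynomial `t ↦ det (1 + t A)` is recovered at `t = 1` from its values at distinct nodes,
with weights that do not depend on `A`. -/
lemma exists_weights_det_one_add_smul {v : ℕ → ℝ} (hv : Function.Injective v) :
    ∃ (s : Finset ℕ) (w : ℕ → ℝ), ∑ i ∈ s, w i = 1 ∧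
      ∀ A : E →L[ℝ] E, (1 + A).det = ∑ i ∈ s, w i * (1 + v i • A).det := by
  classical
  let b := Module.finBasis ℝ E
  set s := Finset.range (Module.finrank ℝ E + 1) with hs
  refine ⟨s, fun i => (Lagrange.basis s v i).eval 1, ?_, fun A => ?_⟩
  · rw [← Polynomial.eval_finsetSum, Lagrange.sum_basis hv.injOn ⟨0, by simp [hs]⟩,
      Polynomial.eval_one]
  let M := LinearMap.toMatrix b b (A : E →ₗ[ℝ] E)
  let p : Polynomial ℝ := Matrix.det ((Polynomial.X : Polynomial ℝ) • M.map Polynomial.C +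
    (1 : Matrix _ _ ℝ).map Polynomial.C)
  have hp (t : ℝ) : (1 + t • A).det = p.eval t := by
    have h1 : (1 + t • A).det = (t • M + 1).det := by
      rw [ContinuousLinearMap.det, ← LinearMap.det_toMatrix b, add_comm]
      congr 1
      simp [M]
    rw [h1, ← Polynomial.coe_evalRingHom, RingHom.map_det]
    congr 1
    ext i j
    by_cases h : i = j <;> simp [h] <;> ring
  have hdeg : p.degree < s.card := by
    refine (Polynomial.degree_le_of_natDegree_le
      (Polynomial.natDegree_det_X_add_C_le M 1)).trans_lt ?_
    simp [hs]
    exact_mod_cast Nat.lt_succ_self _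
  have h1 := hp 1
  rw [one_smul] at h1
  rw [h1, Lagrange.eq_interpolate hv.injOn hdeg, Lagrange.interpolate_apply,
    Polynomial.eval_finsetSum]
  refine Finset.sum_congr rfl fun i _ => ?_
  rw [Polynomial.eval_mul, Polynomial.eval_C, hp, mul_comm]

/-- A small perturbation of the identity that fixes the sphere and preserves the open ball
maps the open ball onto itself. -/
lemma image_ball_eq_of_sphere_fixed {R : ℝ} {f : E → E} (hR : 0 < R) (hf : ContDiff ℝ 1 f)
    (hdet : ∀ x ∈ ball (0 : E) R, (fderiv ℝ f x).det ≠ 0)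
    (hmaps : MapsTo f (ball 0 R) (ball 0 R)) (hfix : ∀ x, ‖x‖ = R → f x = x) :
    f '' ball 0 R = ball 0 R := by
  refine hmaps.image_subset.antisymm ?_
  have hopen : IsOpen (f '' ball 0 R) := by
    rw [isOpen_iff_mem_nhds]
    rintro _ ⟨x, hx, rfl⟩
    let e := ContinuousLinearMap.toContinuousLinearEquivOfDetNeZero _ (hdet x hx)
    have hstrict : HasStrictFDerivAt f (e : E →L[ℝ] E) x := by
      simpa [e] using hf.contDiffAt.hasStrictFDerivAt (x := x) one_ne_zero
    rw [← hstrict.map_nhds_eq_of_equiv]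
    exact image_mem_map (isOpen_ball.mem_nhds hx)
  refine (convex_ball (0 : E) R).isPreconnected.subset_of_closure_inter_subset hopen
    ⟨f 0, hmaps (mem_ball_self hR), 0, mem_ball_self hR, rfl⟩ ?_
  rintro y ⟨hy, hyR⟩
  have hsub : closure (f '' ball 0 R) ⊆ f '' closedBall 0 R :=
    closure_minimal (image_mono ball_subset_closedBall)
      ((isCompact_closedBall 0 R).image hf.continuous).isClosed
  obtain ⟨x, hx, rfl⟩ := hsub hy
  rw [mem_closedBall_zero_iff] at hx
  rcases hx.lt_or_eq with h | h
  · exact ⟨x, mem_ball_zero_iff.2 h, rfl⟩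
  · rw [hfix x h, mem_ball_zero_iff, h] at hyR
    exact absurd hyR (lt_irrefl _)

/-- There is no continuously differentiable retraction of a closed ball onto its sphere. -/
theorem no_contDiff_retraction {R : ℝ} {f : E → E} (hR : 0 < R) (hf : ContDiff ℝ 1 f)
    (hfix : ∀ x, ‖x‖ = R → f x = x) (hnorm : ∀ x, ‖x‖ ≤ R → ‖f x‖ = R) : False := by
  borelize E
  let μ : Measure E := Measure.addHaar
  let u : E → E := fun x => f x - x
  have hu : ContDiff ℝ 1 u := hf.sub contDiff_id
  let A : E → E →L[ℝ] E := fderiv ℝ u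
  have hA : Continuous A := hu.continuous_fderiv one_ne_zero
  have hder (t : ℝ) (x : E) : HasFDerivAt (fun y => y + t • u y) (1 + t • A x) x :=
    (hasFDerivAt_id x).add ((hu.differentiable one_ne_zero x).hasFDerivAt.const_smul t)
  have hdetc : Continuous fun z : ℝ × E => (1 + z.1 • A z.2).det :=
    ContinuousLinearMap.continuous_det.comp (by fun_prop)
  have hvol : ∀ᶠ t in 𝓝[>] (0 : ℝ),
      ∫ x in ball (0 : E) R, (1 + t • A x).det ∂μ = μ.real (ball 0 R) := by
    have hpos : ∀ᶠ t in 𝓝 (0 : ℝ), ∀ x ∈ closedBall (0 : E) R, 0 < (1 + t • A x).det := by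
      refine (isCompact_closedBall (0 : E) R).eventually_forall_of_forall_eventually fun x _ => ?_
      refine hdetc.continuousAt.eventually_const_lt ?_
      simp [ContinuousLinearMap.det]
    obtain ⟨L, hL⟩ := hu.contDiffOn.exists_lipschitzOnWith one_ne_zero
      (convex_closedBall (0 : E) R) (isCompact_closedBall 0 R)
    have hsmall : ∀ᶠ t in 𝓝 (0 : ℝ), t * (L : ℝ) < 1 :=
      (continuous_id.mul continuous_const).continuousAt.eventually_lt_const (by simp)
    filter_upwards [hpos.filter_mono nhdsWithin_le_nhds, hsmall.filter_mono nhdsWithin_le_nhds,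
      Ioo_mem_nhdsGT zero_lt_one] with t htpos htL ht
    have hinj : InjOn (fun y => y + t • u y) (ball (0 : E) R) := by
      intro x hx y hy hxy
      have h1 : x - y = t • (u y - u x) := by
        simp only at hxy
        rw [smul_sub, sub_eq_sub_iff_add_eq_add, hxy, add_comm]
      have h2 : ‖u y - u x‖ ≤ L * ‖x - y‖ := by
        have := hL.norm_sub_le (ball_subset_closedBall hy) (ball_subset_closedBall hx)
        rwa [norm_sub_rev y x] at this
      have h3 : ‖x - y‖ ≤ t * L * ‖x - y‖ := by
        calc ‖x - y‖ = t * ‖u y - u x‖ := by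
              conv_lhs => rw [h1]
              rw [norm_smul, Real.norm_of_nonneg ht.1.le]
          _ ≤ t * (L * ‖x - y‖) := by gcongr; exact ht.1.le
          _ = _ := by ring
      have h4 : ‖x - y‖ = 0 := by nlinarith [norm_nonneg (x - y)]
      exact sub_eq_zero.1 (norm_eq_zero.1 h4)
    have himage : (fun y => y + t • u y) '' ball (0 : E) R = ball 0 R := by
      refine image_ball_eq_of_sphere_fixed hR (contDiff_id.add (hu.const_smul t)) ?_ ?_ ?_
      · intro x hx
        rw [show fderiv ℝ _ x = _ from (hder t x).fderiv]
        exact (htpos x (ball_subset_closedBall hx)).ne'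
      · intro x hx
        rw [mem_ball_zero_iff] at hx ⊢
        have h1 : x + t • u x = (1 - t) • x + t • f x := by
          simp only [u]; module
        change ‖x + t • u x‖ < R
        rw [h1]
        calc ‖(1 - t) • x + t • f x‖ ≤ (1 - t) * ‖x‖ + t * ‖f x‖ := by
              refine (norm_add_le _ _).trans_eq ?_
              rw [norm_smul, norm_smul, Real.norm_of_nonneg ht.1.le,
                Real.norm_of_nonneg (sub_nonneg.2 ht.2.le)]
          _ < R := by rw [hnorm x hx.le]; nlinarith [ht.2]
      · intro x hx
        simp [u, hfix x hx]
    have key := integral_image_eq_integral_abs_det_fderiv_smul μ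
      (measurableSet_ball (x := (0 : E)) (ε := R))
      (fun x _ => (hder t x).hasFDerivWithinAt) hinj (fun _ => (1 : ℝ))
    rw [himage] at key
    simp only [integral_const, smul_eq_mul, mul_one, measureReal_restrict_apply_univ] at key
    rw [key]
    exact setIntegral_congr_fun measurableSet_ball fun x hx =>
      (abs_of_pos (htpos x (ball_subset_closedBall hx))).symm
  obtain ⟨ε, hε, hvolε⟩ := (nhdsGT_basis (0 : ℝ)).eventually_iff.1 hvol
  have hinj : Function.Injective fun n : ℕ => ε / (n + 2) := by
    intro m n h
    have hm : (m : ℝ) + 2 ≠ 0 := by positivity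
    have hn : (n : ℝ) + 2 ≠ 0 := by positivity
    simp only at h
    rw [div_eq_div_iff hm hn] at h
    have := mul_left_cancel₀ hε.ne' h
    exact_mod_cast (add_right_cancel this).symm
  obtain ⟨s, w, hw, hsum⟩ := exists_weights_det_one_add_smul (E := E) hinj
  have hint (t : ℝ) : IntegrableOn (fun x => (1 + t • A x).det) (ball (0 : E) R) μ :=
    ((hdetc.comp (by fun_prop : Continuous fun x : E => (t, x))).continuousOn.integrableOn_compact
      (isCompact_closedBall (0 : E) R)).mono_set ball_subset_closedBall
  have hone : ∫ x in ball (0 : E) R, (1 + A x).det ∂μ = μ.real (ball 0 R) := by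
    rw [integral_congr_ae (.of_forall fun x => hsum (A x)),
      integral_finsetSum _ fun i _ => (hint _).const_mul _]
    simp_rw [integral_const_mul]
    rw [Finset.sum_congr rfl fun i _ => by
      rw [hvolε ⟨by positivity, div_lt_self hε (by linarith [(Nat.cast_nonneg i : (0 : ℝ) ≤ i)])⟩],
      ← Finset.sum_mul, hw, one_mul]
  have hzero : ∫ x in ball (0 : E) R, (1 + A x).det ∂μ = 0 := by
    refine setIntegral_eq_zero_of_forall_eq_zero fun x hx => ?_
    by_contra hne
    have hfd : HasFDerivAt f (1 + A x) x := by
      have := hder 1 x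
      simpa [u] using this
    have hsq : HasFDerivAt (fun y => inner ℝ (f y) (f y)) (0 : E →L[ℝ] ℝ) x := by
      refine (hasFDerivAt_const (R * R) x).congr_of_eventuallyEq ?_
      filter_upwards [isOpen_ball.mem_nhds hx] with y hy
      rw [real_inner_self_eq_norm_mul_norm, hnorm y (mem_ball_zero_iff.1 hy).le]
    have hzero := (hfd.inner ℝ hfd).unique hsq
    obtain ⟨z, hz⟩ := (ContinuousLinearMap.toContinuousLinearEquivOfDetNeZero _ hne).surjective (f x)
    have h := DFunLike.congr_fun hzero z
    have hz' : z + A x z = f x := by simpa using hz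
    simp [fderivInnerCLM_apply, hz', hnorm x (mem_ball_zero_iff.1 hx).le] at h
    exact hR.ne' h
  rw [hone] at hzero
  exact (ENNReal.toReal_pos (isOpen_ball.measure_pos μ ⟨0, mem_ball_self hR⟩).ne'
    measure_ball_lt_top.ne).ne' hzero

/-- A version of the Brouwer fixed point theorem for bounded continuously differentiable maps. -/
theorem exists_fixedPoint_of_contDiff_of_bounded {g : E → E} {M : ℝ} (hg : ContDiff ℝ 1 g)
    (hM : ∀ x, ‖g x‖ ≤ M) : ∃ x, g x = x := by
  by_contra! hne
  have hM0 : 0 ≤ M := (norm_nonneg _).trans (hM 0)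
  let χ : ContDiffBump (0 : E) := ⟨M + 1, M + 2, by linarith, by linarith⟩
  let F : E → E := fun x => x - χ x • g x
  have hF : ContDiff ℝ 1 F := contDiff_id.sub (χ.contDiff.smul hg)
  have hF0 (x : E) : F x ≠ 0 := by
    intro h
    have hx : x = χ x • g x := sub_eq_zero.1 h
    have hnorm : ‖x‖ ≤ M := by
      rw [hx, norm_smul, Real.norm_of_nonneg χ.nonneg]
      nlinarith [hM x, χ.nonneg (x := x), χ.le_one (x := x), norm_nonneg (g x)]
    have h1 : χ x = 1 := χ.one_of_mem_closedBall (by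
      rw [mem_closedBall_zero_iff]; change ‖x‖ ≤ M + 1; linarith)
    rw [h1, one_smul] at hx
    exact hne x hx.symm
  refine no_contDiff_retraction (R := M + 3) (f := fun x => ((M + 3) / ‖F x‖) • F x)
    (by linarith) ?_ ?_ ?_
  · exact (contDiff_const.div (hF.norm ℝ hF0) fun x => norm_ne_zero_iff.2 (hF0 x)).smul hF
  · intro x hx
    have h0 : χ x = 0 := χ.zero_of_le_dist (by
      rw [dist_zero_right, hx]; change M + 2 ≤ M + 3; linarith)
    have : F x = x := by simp [F, h0]
    simp only [this, hx]
    rw [div_self (by linarith), one_smul]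
  · intro x _
    rw [norm_smul, norm_div, norm_norm, div_mul_cancel₀ _ (norm_ne_zero_iff.2 (hF0 x)),
      Real.norm_of_nonneg (by linarith)]

end Brouwer

namespace GrainOfTruth

/-- Probability that the bit received after `pre` is `b`; zero if the machine diverges. -/
noncomputable def stepProb (T : Machine) (O : Query → ℝ) (x pre : List Bool) (b : Bool) : ℝ :=
  open scoped Classical in
  if h : (act T x pre).Dom then bitProb O ((act T x pre).get h) b else 0

lemma traceWeightAux_cons (T : Machine) (O : Query → ℝ) (x pre : List Bool) (b : Bool)
    (s : List Bool) : traceWeightAux T O x pre (b :: s) =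
      stepProb T O x pre b * traceWeightAux T O x (pre ++ [b]) s := rfl

lemma stepProb_of_output {T : Machine} {O : Query → ℝ} {x pre : List Bool} {c : Bool}
    (h : act T x pre = Part.some (.output c)) (b : Bool) : stepProb T O x pre b = 0 := by
  simp [stepProb, h, bitProb]

lemma stepProb_nonneg {O : Query → ℝ} (hO : IsOracle O) (T : Machine) (x pre : List Bool)
    (b : Bool) : 0 ≤ stepProb T O x pre b := by
  unfold stepProb
  split_ifs with h
  · rcases (act T x pre).get h with c | _ | q
    · simp [bitProb]
    · simp [bitProb]
    · cases b <;> simp [bitProb, hO q]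
  · rfl

lemma stepProb_add_le_one (T : Machine) (O : Query → ℝ) (x pre : List Bool) :
    stepProb T O x pre true + stepProb T O x pre false ≤ 1 := by
  unfold stepProb
  split_ifs with h
  · rcases (act T x pre).get h with c | _ | q <;> norm_num [bitProb]
  · norm_num

lemma traceWeightAux_nonneg {O : Query → ℝ} (hO : IsOracle O) (T : Machine) (x pre s : List Bool) :
    0 ≤ traceWeightAux T O x pre s := by
  induction s generalizing pre with
  | nil => exact zero_le_one
  | cons b s ih => exact mul_nonneg (stepProb_nonneg hO T x pre b) (ih _)

/-- Halting traces are prefix-free, so their total weight is at most one. -/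
lemma sum_traceWeightAux_le_one {O : Query → ℝ} (hO : IsOracle O) (T : Machine) (x : List Bool)
    (N : ℕ) (S : Finset (List Bool)) (pre : List Bool) (hN : ∀ s ∈ S, s.length < N)
    (hS : ∀ s ∈ S, ∃ b, act T x (pre ++ s) = Part.some (.output b)) :
    ∑ s ∈ S, traceWeightAux T O x pre s ≤ 1 := by
  classical
  induction N generalizing S pre with
  | zero =>
    rw [Finset.eq_empty_of_forall_notMem fun s hs => (hN s hs).not_ge (Nat.zero_le _)]
    simp
  | succ N ih =>
    by_cases hnil : [] ∈ S
    · obtain ⟨c, hc⟩ := hS [] hnil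
      rw [List.append_nil] at hc
      rw [Finset.sum_eq_single [] ?_ fun h => absurd hnil h]
      · exact le_rfl
      · rintro (_ | ⟨b, s⟩) _ hne
        · exact absurd rfl hne
        · rw [traceWeightAux_cons, stepProb_of_output hc, zero_mul]
    · have hbranch (b : Bool) : ∑ s ∈ S with s ∈ Set.range (List.cons b),
          traceWeightAux T O x pre s ≤ stepProb T O x pre b := by
        have hinj : Set.InjOn (List.cons b) (List.cons b ⁻¹' ↑S) :=
          List.cons_injective.injOn
        rw [← Finset.sum_preimage' (List.cons b) S hinj]
        simp_rw [traceWeightAux_cons]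
        rw [← Finset.mul_sum]
        refine mul_le_of_le_one_right (stepProb_nonneg hO T x pre b) (ih _ _ ?_ ?_)
        · intro s hs
          exact Nat.lt_of_succ_lt_succ (hN _ (Finset.mem_preimage.1 hs))
        · intro s hs
          simpa using hS _ (Finset.mem_preimage.1 hs)
      rw [← Finset.sum_filter_add_sum_filter_not S (· ∈ Set.range (List.cons true))]
      refine (add_le_add (hbranch true) ?_).trans (stepProb_add_le_one T O x pre)
      refine le_trans (le_of_eq (Finset.sum_congr (Finset.filter_congr ?_) fun _ _ => rfl))
        (hbranch false)
      rintro (_ | ⟨_ | _, s⟩) hs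
      · exact absurd hs hnil
      · simp
      · simp

open scoped Classical in
/-- The probability that `T` outputs `b` after receiving one of the traces in `S`. -/
noncomputable def lamPartial (S : Finset (List Bool)) (T : Machine) (O : Query → ℝ)
    (x : List Bool) (b : Bool) : ℝ :=
  ∑ s ∈ S with act T x s = Part.some (.output b), traceWeightAux T O x [] s

lemma lamPartial_mono {O : Query → ℝ} (hO : IsOracle O) {S S' : Finset (List Bool)} (h : S ⊆ S')
    (T : Machine) (x : List Bool) (b : Bool) :
    lamPartial S T O x b ≤ lamPartial S' T O x b :=
  open scoped Classical in
  Finset.sum_le_sum_of_subset_of_nonneg (Finset.filter_subset_filter _ h)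
    fun s _ _ => traceWeightAux_nonneg hO T x [] s

lemma lamPartial_add_le_one {O : Query → ℝ} (hO : IsOracle O) (S : Finset (List Bool))
    (T : Machine) (x : List Bool) :
    lamPartial S T O x true + lamPartial S T O x false ≤ 1 := by
  classical
  unfold lamPartial
  rw [← Finset.sum_union]
  · refine sum_traceWeightAux_le_one hO T x (S.sup List.length + 1) _ [] ?_ ?_
    · intro s hs
      have : s ∈ S := by
        rcases Finset.mem_union.1 hs with h | h <;> exact (Finset.mem_filter.1 h).1
      exact Nat.lt_succ_of_le (Finset.le_sup (f := List.length) this)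
    · intro s hs
      rcases Finset.mem_union.1 hs with h | h <;> exact ⟨_, (Finset.mem_filter.1 h).2⟩
  · refine Finset.disjoint_left.2 fun s h1 h2 => ?_
    simpa using Part.some_inj.1
      ((Finset.mem_filter.1 h1).2.symm.trans (Finset.mem_filter.1 h2).2)

lemma exists_lt_lamPartial {O : Query → ℝ} (hO : IsOracle O) {T : Machine} {x : List Bool}
    {b : Bool} {r : ℝ} (h : r < lam T O x b) : ∃ S, r < lamPartial S T O x b := by
  classical
  have heq (u : Finset {s : List Bool // act T x s = Part.some (Action.output b)}) :
      ∑ s ∈ u, traceWeightAux T O x [] s.1 =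
        lamPartial (u.map (Function.Embedding.subtype _)) T O x b := by
    rw [lamPartial, Finset.filter_true_of_mem, Finset.sum_map]
    · rfl
    · intro s hs
      obtain ⟨s, -, rfl⟩ := Finset.mem_map.1 hs
      exact s.2
  have hsum : Summable fun s : {s : List Bool // act T x s = Part.some (Action.output b)} =>
      traceWeightAux T O x [] s.1 := by
    refine summable_of_sum_le (c := 1) (fun s => traceWeightAux_nonneg hO T x [] s.1) fun u => ?_
    refine sum_traceWeightAux_le_one hO T x _ (u.map (Function.Embedding.subtype _)) []
      (fun s hs => Nat.lt_succ_of_le (Finset.le_sup (f := List.length) hs)) ?_ |>.trans' ?_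
    · intro s hs
      obtain ⟨s, -, rfl⟩ := Finset.mem_map.1 hs
      exact ⟨b, s.2⟩
    · rw [Finset.sum_map]
      rfl
  obtain ⟨u, hu⟩ := (hsum.hasSum.eventually_const_lt h).exists
  exact ⟨_, (heq u) ▸ hu⟩

lemma continuous_traceWeightAux (T : Machine) (x pre s : List Bool) :
    Continuous fun O : Query → ℝ => traceWeightAux T O x pre s := by
  induction s generalizing pre with
  | nil => exact continuous_const
  | cons b s ih =>
    refine Continuous.mul ?_ (ih _)
    split_ifs with h
    · rcases (act T x pre).get h with c | _ | q
      · exact continuous_const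
      · exact continuous_const
      · cases b
        · exact continuous_const.sub (continuous_apply q)
        · exact continuous_apply q
    · exact continuous_const

lemma contDiff_traceWeightAux {E : Type*} [NormedAddCommGroup E] [NormedSpace ℝ E] {n : WithTop ℕ∞}
    {O : E → Query → ℝ} (hO : ∀ q, ContDiff ℝ n fun v => O v q) (T : Machine)
    (x pre s : List Bool) : ContDiff ℝ n fun v => traceWeightAux T (O v) x pre s := by
  induction s generalizing pre with
  | nil => exact contDiff_const
  | cons b s ih =>
    refine ContDiff.mul ?_ (ih _)
    split_ifs with h
    · rcases (act T x pre).get h with c | _ | q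
      · exact contDiff_const
      · exact contDiff_const
      · cases b
        · exact contDiff_const.sub (hO q)
        · exact hO q
    · exact contDiff_const

/-- The queries and traces kept by a finite truncation, and the steepness of its responses. -/
abbrev TruncationIndex := Finset Query × Finset (List Bool) × ℕ

/-- For finitely many queries and traces there is an oracle whose answers are a smooth response,
of steepness `K`, to the corresponding truncated output probabilities. -/
lemma exists_oracle_eq_sigmoid (Q : Finset Query) (S : Finset (List Bool)) (K : ℝ) :
    ∃ O, IsOracle O ∧ ∀ (T : Machine) (x : List Bool) (p : ℚ), (T, x, p) ∈ Q →
      O (T, x, p) = Real.sigmoid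
        (K * (lamPartial S T O x true - lamPartial S T O x false + 1 - 2 * p)) := by
  classical
  let extend : EuclideanSpace ℝ Q → Query → ℝ := fun v q => if h : q ∈ Q then v ⟨q, h⟩ else 0
  have hext (q : Query) : ContDiff ℝ 1 fun v => extend v q := by
    by_cases h : q ∈ Q
    · simp only [extend, h, dite_true]
      fun_prop
    · simp only [extend, h, dite_false]
      exact contDiff_const
  have hlam (T : Machine) (x : List Bool) (b : Bool) :
      ContDiff ℝ 1 fun v => lamPartial S T (extend v) x b :=
    ContDiff.sum fun s _ => contDiff_traceWeightAux hext T x [] s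
  let g : EuclideanSpace ℝ Q → EuclideanSpace ℝ Q := fun v => WithLp.toLp 2 fun q =>
    Real.sigmoid (K * (lamPartial S q.1.1 (extend v) q.1.2.1 true -
      lamPartial S q.1.1 (extend v) q.1.2.1 false + 1 - 2 * q.1.2.2))
  have hg : ContDiff ℝ 1 g := by
    rw [contDiff_euclidean]
    intro q
    exact (contDiff_sigmoid.of_le le_top).comp (contDiff_const.mul
      ((((hlam _ _ _).sub (hlam _ _ _)).add contDiff_const).sub contDiff_const))
  have hbound (v : EuclideanSpace ℝ Q) : ‖g v‖ ≤ √(∑ _q : Q, 1) := by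
    rw [EuclideanSpace.norm_eq]
    refine Real.sqrt_le_sqrt (Finset.sum_le_sum fun q _ => ?_)
    rw [Real.norm_eq_abs, sq_abs]
    exact pow_le_one₀ (Real.sigmoid_nonneg _) (Real.sigmoid_le_one _)
  obtain ⟨v, hv⟩ := exists_fixedPoint_of_contDiff_of_bounded hg hbound
  have hval (q : Query) (hq : q ∈ Q) : extend v q = g v ⟨q, hq⟩ := by
    simp only [extend, hq, dite_true, hv]
  refine ⟨extend v, fun q => ?_, fun T x p hq => hval _ hq⟩
  by_cases hq : q ∈ Q
  · rw [hval q hq]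
    exact ⟨Real.sigmoid_nonneg _, Real.sigmoid_le_one _⟩
  · simp [extend, hq]

/-- Output probabilities are lower semicontinuous along limits of oracles and trace sets. -/
lemma exists_eventually_le_lamPartial {ι : Type*} {l : Filter ι} {o : ι → Query → ℝ}
    {σ : ι → Finset (List Bool)} {O : Query → ℝ} (hO : IsOracle O) (ho : ∀ i, IsOracle (o i))
    (hlim : Tendsto o l (𝓝 O)) (hσ : Tendsto σ l atTop) {T : Machine} {x : List Bool} {b : Bool}
    {r : ℝ} (h : r < lam T O x b) :
    ∃ c, r < c ∧ ∀ᶠ i in l, c ≤ lamPartial (σ i) T (o i) x b := by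
  obtain ⟨S, hS⟩ := exists_lt_lamPartial hO h
  obtain ⟨c, hrc, hcS⟩ := exists_between hS
  have hcont : Continuous fun O : Query → ℝ => lamPartial S T O x b :=
    continuous_finsetSum _ fun s _ => continuous_traceWeightAux T x [] s
  refine ⟨c, hrc, ?_⟩
  filter_upwards [((hcont.tendsto O).comp hlim).eventually_const_lt hcS,
    hσ.eventually_ge_atTop S] with i hi hSi
  exact hi.le.trans (lamPartial_mono (ho i) hSi T x b)

end GrainOfTruth

open GrainOfTruth in
theorem exists_reflective_oracle :
    ∃ O : GrainOfTruth.Query → ℝ, GrainOfTruth.Reflective O := by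
  classical
  choose o ho hval using fun i : TruncationIndex =>
    exists_oracle_eq_sigmoid i.1 i.2.1 i.2.2
  let U : Ultrafilter TruncationIndex := Ultrafilter.of atTop
  have hU : (U : Filter TruncationIndex) ≤ atTop := Ultrafilter.of_le atTop
  have hcompact : IsCompact (Set.univ.pi fun _ : Query => Set.Icc (0 : ℝ) 1) :=
    isCompact_univ_pi fun _ => isCompact_Icc
  obtain ⟨O, hO, hlim⟩ := hcompact.ultrafilter_le_nhds (U.map o)
    (le_principal_iff.2 (Ultrafilter.mem_map.2 (univ_mem' fun i q _ => ho i q)))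
  replace hO : IsOracle O := fun q => hO q trivial
  have hlim : Tendsto o U (𝓝 O) := hlim
  have hσ : Tendsto (fun i : TruncationIndex => i.2.1) U atTop :=
    (tendsto_atTop_atTop.2 fun S => ⟨(∅, S, 0), fun _ h => by exact h.2.1⟩).mono_left hU
  have hK : Tendsto (fun i : TruncationIndex => (i.2.2 : ℝ)) U atTop :=
    tendsto_natCast_atTop_atTop.comp
      ((tendsto_atTop_atTop.2 fun n => ⟨(∅, ∅, n), fun _ h => by exact h.2.2⟩).mono_left hU)
  have hQ (q : Query) : ∀ᶠ i in (U : Filter TruncationIndex), q ∈ i.1 := by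
    filter_upwards [hU (eventually_ge_atTop ({q}, ∅, 0))] with i hi
    exact hi.1 (Finset.mem_singleton_self q)
  refine ⟨O, hO, fun T x p => ⟨fun h => ?_, fun h => ?_⟩⟩
  · obtain ⟨c, hc, hev⟩ := exists_eventually_le_lamPartial hO ho hlim hσ h
    have hsig : Tendsto (fun i : TruncationIndex =>
        Real.sigmoid (i.2.2 * (2 * (c - p)))) U (𝓝 1) :=
      Real.tendsto_sigmoid_atTop.comp (hK.atTop_mul_const (by linarith))
    refine le_antisymm (hO _).2 (le_of_tendsto_of_tendsto hsig (hlim.apply_nhds _) ?_)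
    filter_upwards [hev, hQ (T, x, p)] with i hi hq
    rw [hval i T x p hq]
    have := lamPartial_add_le_one (ho i) i.2.1 T x
    exact Real.sigmoid_monotone (mul_le_mul_of_nonneg_left (by linarith) (Nat.cast_nonneg _))
  · obtain ⟨c, hc, hev⟩ := exists_eventually_le_lamPartial hO ho hlim hσ h
    have hsig : Tendsto (fun i : TruncationIndex =>
        Real.sigmoid (i.2.2 * (2 * (1 - p - c)))) U (𝓝 0) :=
      Real.tendsto_sigmoid_atBot.comp (hK.atTop_mul_const_of_neg (by linarith))
    refine le_antisymm (le_of_tendsto_of_tendsto (hlim.apply_nhds _) hsig ?_) (hO _).1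
    filter_upwards [hev, hQ (T, x, p)] with i hi hq
    rw [hval i T x p hq]
    have := lamPartial_add_le_one (ho i) i.2.1 T x
    exact Real.sigmoid_monotone (mul_le_mul_of_nonneg_left (by linarith) (Nat.cast_nonneg _))
end

section
/- Let T ∈ 𝒯 be the probabilistic Turing machine that (knowing its own source code by quining) queries the oracle with (T, ε, 1/2) and outputs 1 minus the oracle's answer, i.e., outputs 1 − O(T, ε, 1/2). Then for every reflective oracle O it holds that O(T, ε, 1/2) = 1/2, i.e., on this query the oracle answers 0 and 1 each with probability exactly 1/2, and consequently λ_T^O(1|ε) = λ_T^O(0|ε) = 1/2. -/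
namespace GrainOfTruth

/-- Quining: some machine asks about itself after the empty bit string and negates the answer. -/
theorem exists_diagonal_machine :
    ∃ T : Machine,
      act T [] [] = Part.some (Action.ask (T, ([] : List Bool), (1 / 2 : ℚ))) ∧
      ∀ b : Bool, act T [] [b] = Part.some (Action.output (!b)) := by
  obtain ⟨k, hk⟩ : ∃ k, ∀ c : Machine, Nat.pair (Encodable.encode c) k =
      Denumerable.eqv Query (c, ([] : List Bool), (1 / 2 : ℚ)) :=
    ⟨Denumerable.eqv (List Bool × ℚ) ([], 1 / 2), fun _ => rfl⟩
  obtain ⟨code, hcode, hinj⟩ : ∃ code : List Bool → ℕ,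
      (∀ s, Nat.pair (Encodable.encode ([] : List Bool)) (Encodable.encode s) = code s) ∧
        Function.Injective code :=
    ⟨_, fun _ => rfl, fun _ _ h => Encodable.encode_injective (Nat.pair_eq_pair.1 h).2⟩
  let g : Machine → ℕ → ℕ := fun c n =>
    if n = code [] then Nat.pair (Encodable.encode c) k + 3
    else if n = code [false] then 1
    else 0
  have hg : Computable₂ g := by
    refine Primrec₂.to_comp ?_
    refine Primrec.ite (Primrec.eq.comp Primrec.snd (Primrec.const _)) ?_
      (Primrec.ite (Primrec.eq.comp Primrec.snd (Primrec.const _)) (Primrec.const _)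
        (Primrec.const _))
    exact Primrec.nat_add.comp
      (Primrec₂.natPair.comp (Primrec.encode.comp Primrec.fst) (Primrec.const _))
      (Primrec.const _)
  obtain ⟨T, hT⟩ := Nat.Partrec.Code.fixed_point₂ (f := fun c n => Part.some (g c n)) hg.partrec₂
  have hact (s : List Bool) : act T [] s = Part.some (decodeAction (g T (code s))) := by
    rw [act, hcode, hT, Part.map_some]
  refine ⟨T, ?_, fun b => ?_⟩
  · have h : g T (code []) = Denumerable.eqv Query (T, ([] : List Bool), (1 / 2 : ℚ)) + 3 := by
      rw [← hk]
      exact if_pos rfl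
    rw [hact, h, decodeAction]
    exact congrArg (fun q => Part.some (Action.ask q)) ((Denumerable.eqv Query).symm_apply_apply _)
  · rw [hact]
    cases b <;> simp [g, decodeAction, hinj.eq_iff]

variable {T : Machine} {O : Query → ℝ} {x : List Bool}

theorem traceWeightAux_cons_eq_zero_of_output {pre : List Bool} {c : Bool}
    (h : act T x pre = Part.some (Action.output c)) (b : Bool) (s : List Bool) :
    traceWeightAux T O x pre (b :: s) = 0 := by
  simp [traceWeightAux, h, bitProb]

theorem traceWeightAux_singleton_of_ask {pre : List Bool} {q : Query}
    (h : act T x pre = Part.some (Action.ask q)) (b : Bool) :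
    traceWeightAux T O x pre [b] = if b then O q else 1 - O q := by
  simp [traceWeightAux, h, bitProb]

/-- A machine that asks one question and outputs the negated answer has the law of the
negated answer. -/
theorem lam_of_ask_then_negate {q : Query} (h₀ : act T x [] = Part.some (Action.ask q))
    (h₁ : ∀ b : Bool, act T x [b] = Part.some (Action.output (!b))) (b : Bool) :
    lam T O x b = if b then 1 - O q else O q := by
  have hb : act T x [!b] = Part.some (Action.output b) := by simpa using h₁ (!b)
  unfold lam
  rw [tsum_eq_single ⟨[!b], hb⟩]
  · rw [traceWeightAux_singleton_of_ask h₀]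
    cases b <;> simp
  · rintro ⟨s, hs⟩ hne
    match s, hs, hne with
    | [], hs, _ => simp [h₀] at hs
    | [a], hs, hne =>
      rw [h₁, Part.some_inj] at hs
      injection hs with hs
      subst hs
      simp at hne
    | a :: a' :: s, _, _ =>
      rw [traceWeightAux, List.nil_append, traceWeightAux_cons_eq_zero_of_output (h₁ a), mul_zero]

end GrainOfTruth

open GrainOfTruth in
/-- Diagonalization example: there is a machine `T` which (knowing its own source code
by quining) queries the oracle with `(T, ε, 1/2)` and outputs the negation of the
oracle's answer.  For every reflective oracle `O`, on this query the oracle must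
randomize with equal probabilities, `O(T, ε, 1/2) = 1/2`, and consequently
λ_T^O(1|ε) = λ_T^O(0|ε) = 1/2. -/
theorem diagonalization_machine_forces_randomization :
    ∃ T : Machine,
      (act T [] [] = Part.some (Action.ask (T, ([] : List Bool), (1 / 2 : ℚ)))) ∧
      (∀ b : Bool, act T [] [b] = Part.some (Action.output (!b))) ∧
      ∀ O : Query → ℝ, Reflective O →
        O (T, ([] : List Bool), (1 / 2 : ℚ)) = 1 / 2 ∧
        lam T O [] true = 1 / 2 ∧ lam T O [] false = 1 / 2 := by
  obtain ⟨T, h₀, h₁⟩ := exists_diagonal_machine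
  refine ⟨T, h₀, h₁, fun O hO => ?_⟩
  have ht : lam T O [] true = 1 - O (T, [], 1 / 2) := by
    simpa using lam_of_ask_then_negate h₀ h₁ true
  have hf : lam T O [] false = O (T, [], 1 / 2) := by
    simpa using lam_of_ask_then_negate h₀ h₁ false
  obtain ⟨hone, hzero⟩ := hO.2 T [] (1 / 2)
  rw [ht] at hone
  rw [hf] at hzero
  push_cast at hone hzero
  have hO_eq : O (T, [], 1 / 2) = 1 / 2 := by
    rcases lt_trichotomy (O (T, [], 1 / 2)) (1 / 2) with h | h | h
    · linarith [hone (by linarith)]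
    · exact h
    · linarith [hzero (by linarith)]
  refine ⟨hO_eq, ?_, ?_⟩ <;> linarith
end
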